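/- Let S_a be a convergent interpolatory subdivision scheme with dilation mI, |m| ≥ 2, i.e., its finitely supported mask satisfies a_0 = 1 and a_{mα} = 0 for all α ∈ ℤ^s ∖ {0}, and let k ∈ ℕ_0. If the symbol satisfies a(1,…,1) = |m|^s and (D^j a)(ε) = 0 for every ε ∈ Ξ′ and every multi-index j with |j| ≤ k (i.e., the scheme generates polynomials up to degree k), then S_a reproduces polynomials up to degree k with the standard parameter values t^{(r)}_α = α/m^r (offset τ = 0). -/

import Mathlib

open Finset Filter

noncomputable section

/-- Sequences indexed by `ℤ^s`. -/
abbrev ZS (s : ℕ) := Fin s → ℤ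

/-- `z^α = z_1^{α_1} ⋯ z_s^{α_s}` for `z ∈ ℂ^s`, `α ∈ ℤ^s`. -/
def zpowV {s : ℕ} (z : Fin s → ℂ) (α : Fin s → ℤ) : ℂ := ∏ i, z i ^ α i

/-- The tensor-product falling factorial polynomial
`q_j(x) = ∏_i ∏_{ℓ=0}^{j_i-1} (x_i - ℓ)` (complex version). -/
def qpolyC {s : ℕ} (j : Fin s → ℕ) (x : Fin s → ℂ) : ℂ :=
  ∏ i, ∏ l ∈ Finset.range (j i), (x i - l)

/-- The tensor-product falling factorial polynomial (real version). -/
def qpolyR {s : ℕ} (j : Fin s → ℕ) (x : Fin s → ℝ) : ℝ :=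
  ∏ i, ∏ l ∈ Finset.range (j i), (x i - l)

/-- `(D^j a)(z) = ∑_α q_j(α) a_α z^{α-j}`, the `j`-th iterated partial derivative of the symbol
`a(z) = ∑_α a_α z^α`.  For `j = 0` this is the symbol itself. -/
def symbolD {s : ℕ} (a : ZS s → ℝ) (j : Fin s → ℕ) (z : Fin s → ℂ) : ℂ :=
  ∑ᶠ α : ZS s, qpolyC j (fun i => (α i : ℂ)) * (a α : ℂ) * zpowV z (fun i => α i - (j i : ℤ))

/-- The point `(1,…,1) ∈ ℂ^s`. -/
def onesC {s : ℕ} : Fin s → ℂ := fun _ => 1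

/-- `e ∈ E = {0,…,|m|-1}^s`. -/
def inE {s : ℕ} (m : ℤ) (e : ZS s) : Prop := ∀ i, 0 ≤ e i ∧ e i < |m|

/-- `ε_e = (e^{-2πi e_1/m}, …, e^{-2πi e_s/m}) ∈ ℂ^s`. -/
def epsPt {s : ℕ} (m : ℤ) (e : ZS s) : Fin s → ℂ :=
  fun i => Complex.exp (-(2 * Real.pi * Complex.I * e i) / m)

/-- The subdivision operator `(S_a d)_α = ∑_β a_{α-mβ} d_β`. -/
def subdOp {s : ℕ} (m : ℤ) (a : ZS s → ℝ) (d : ZS s → ℝ) : ZS s → ℝ :=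
  fun α => ∑ᶠ β : ZS s, a (α - m • β) * d β

/-- The parameter values `t^{(r)}_α = α/m^r - τ ∑_{i=1}^r m^{-i}` attached to the data at
level `r`. -/
def param {s : ℕ} (m : ℤ) (τ : Fin s → ℝ) (r : ℕ) (α : ZS s) : Fin s → ℝ :=
  fun i => (α i : ℝ) / (m : ℝ) ^ r - τ i * ∑ n ∈ Finset.range r, ((m : ℝ) ^ (n + 1))⁻¹

/-- The subdivision scheme `S_a` (with dilation `mI` and parametrization offset `τ`) converges
from initial data `d` to the limit `g`: there are continuous functions `F^{(r)}` interpolating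
the data `S_a^r d` at the parameter values `t^{(r)}`, converging uniformly to `g`. -/
def ConvergesTo {s : ℕ} (m : ℤ) (a : ZS s → ℝ) (τ : Fin s → ℝ)
    (d : ZS s → ℝ) (g : (Fin s → ℝ) → ℝ) : Prop :=
  ∃ F : ℕ → (Fin s → ℝ) → ℝ,
    (∀ r, Continuous (F r)) ∧
    (∀ r α, F r (param m τ r α) = (subdOp m a)^[r] d α) ∧
    TendstoUniformly F g atTop

/-- Bounded data. -/
def Bdd {s : ℕ} (d : ZS s → ℝ) : Prop := ∃ C, ∀ α, |d α| ≤ C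

/-- The subdivision scheme is convergent: every bounded initial data admits a limit. -/
def Convergent {s : ℕ} (m : ℤ) (a : ZS s → ℝ) (τ : Fin s → ℝ) : Prop :=
  ∀ d, Bdd d → ∃ g, ConvergesTo m a τ d g

/-- The subdivision scheme is non-singular: it is convergent and a zero limit forces zero data. -/
def NonSingular {s : ℕ} (m : ℤ) (a : ZS s → ℝ) (τ : Fin s → ℝ) : Prop :=
  Convergent m a τ ∧
  ∀ d, Bdd d → ∀ g, ConvergesTo m a τ d g → g = 0 → (∀ α, d α = 0)

/-- `S_a` reproduces polynomials up to degree `k`: for every `s`-variate real polynomial `π` of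
total degree at most `k`, the scheme converges from the data `(π(α))_α` to the limit `π`. -/
def Reproduces {s : ℕ} (m : ℤ) (a : ZS s → ℝ) (τ : Fin s → ℝ) (k : ℕ) : Prop :=
  ∀ π : MvPolynomial (Fin s) ℝ, π.totalDegree ≤ k →
    ConvergesTo m a τ (fun α => MvPolynomial.eval (fun i => (α i : ℝ)) π)
      (fun x => MvPolynomial.eval x π)

/-- `S_a` is step-wise polynomial reproducing up to degree `k`:
`S_a (π(t^{(r)}_·)) = π(t^{(r+1)}_·)` for every polynomial `π` of total degree at most `k`. -/
def StepwiseReproduces {s : ℕ} (m : ℤ) (a : ZS s → ℝ) (τ : Fin s → ℝ) (k : ℕ) : Prop :=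
  ∀ π : MvPolynomial (Fin s) ℝ, π.totalDegree ≤ k → ∀ r : ℕ, ∀ α : ZS s,
    subdOp m a (fun β => MvPolynomial.eval (param m τ r β) π) α
      = MvPolynomial.eval (param m τ (r + 1) α) π

/-- Condition `Z_k`: `a(1,…,1) = |m|^s` and `(D^j a)(ε) = 0` for all `ε ∈ Ξ'` and `|j| < k`. -/
def CondZ {s : ℕ} (m : ℤ) (a : ZS s → ℝ) (k : ℕ) : Prop :=
  symbolD a 0 onesC = ((|m| : ℤ) : ℂ) ^ s ∧
  ∀ e : ZS s, inE m e → e ≠ 0 → ∀ j : Fin s → ℕ, (∑ i, j i) < k →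
    symbolD a j (epsPt m e) = 0

/-- Powers of an affine function expand in falling factorials of no larger degree. -/
lemma affine_pow_eq_sum_falling (u v : ℂ) (n : ℕ) :
    ∃ c : ℕ → ℂ, ∀ x : ℂ, (u + v * x) ^ n =
      ∑ l ∈ Finset.range (n + 1), c l * ∏ i ∈ Finset.range l, (x - i) := by
  induction n with
  | zero => exact ⟨fun _ => 1, fun x => by simp⟩
  | succ n ih =>
    obtain ⟨c, hc⟩ := ih
    refine ⟨fun l => (if l ≤ n then c l * (u + v * l) else 0) +
      (if l = 0 then 0 else c (l - 1) * v), fun x => ?_⟩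
    rw [pow_succ, hc x]
    simp only [add_mul, Finset.sum_add_distrib]
    rw [Finset.sum_range_succ (fun l => (if l ≤ n then c l * (u + v * l) else 0) * _),
      Finset.sum_range_succ' (fun l => (if l = 0 then (0 : ℂ) else c (l - 1) * v) * _)]
    simp only [Nat.succ_ne_zero, if_false, Nat.add_sub_cancel, if_true, zero_mul, add_zero,
      show ¬ n + 1 ≤ n by omega]
    rw [← Finset.sum_add_distrib, Finset.sum_mul]
    refine Finset.sum_congr rfl fun l hl => ?_
    rw [if_pos (by simpa [Nat.lt_succ_iff] using hl), Finset.prod_range_succ]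
    ring

/-- Orthogonality of the characters of `ℤ/mℤ`. -/
lemma sum_exp_zpow_eq_ite {m : ℤ} (hm : m ≠ 0) (x : ℤ) :
    ∑ e ∈ Finset.Ico 0 |m|, Complex.exp (-(2 * Real.pi * Complex.I * (e : ℤ)) / m) ^ x =
      if m ∣ x then ((|m| : ℤ) : ℂ) else 0 := by
  have hmC : (m : ℂ) ≠ 0 := by exact_mod_cast hm
  have habs : |m| = (m.natAbs : ℤ) := Int.abs_eq_natAbs m
  set y : ℂ := Complex.exp (-(2 * Real.pi * Complex.I * x) / m) with hy
  have hterm : ∀ n : ℕ,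
      Complex.exp (-(2 * Real.pi * Complex.I * ((n : ℤ) : ℂ)) / m) ^ x = y ^ n := by
    intro n
    rw [hy, ← Complex.exp_int_mul, ← Complex.exp_nat_mul]
    congr 1
    push_cast
    ring
  have hsum : ∑ e ∈ Finset.Ico 0 |m|,
      Complex.exp (-(2 * Real.pi * Complex.I * (e : ℤ)) / m) ^ x =
        ∑ n ∈ Finset.range m.natAbs, y ^ n := by
    refine (Finset.sum_nbij (fun n : ℕ => (n : ℤ)) ?_ ?_ ?_ ?_).symm
    · intro n hn
      simp only [Finset.mem_range] at hn
      rw [Finset.mem_Ico, habs]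
      omega
    · intro p _ q _ h
      exact Int.ofNat_injective h
    · intro e he
      rw [Finset.coe_Ico, Set.mem_Ico, habs] at he
      refine ⟨e.toNat, ?_, ?_⟩
      · simp only [Finset.coe_range, Set.mem_Iio]
        omega
      · simpa using he.1
    · intro n _
      exact (hterm n).symm
  have hpi : (2 * Real.pi * Complex.I : ℂ) ≠ 0 := Complex.two_pi_I_ne_zero
  have hone : y = 1 ↔ m ∣ x := by
    rw [hy, Complex.exp_eq_one_iff]
    constructor
    · rintro ⟨n, hn⟩
      refine ⟨-n, ?_⟩
      rw [div_eq_iff hmC] at hn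
      have : (2 * Real.pi * Complex.I : ℂ) * x = (2 * Real.pi * Complex.I) * (m * (-n)) := by
        linear_combination -hn
      exact_mod_cast mul_left_cancel₀ hpi this
    · rintro ⟨n, rfl⟩
      refine ⟨-n, ?_⟩
      push_cast
      field_simp
  have hroot : y ^ m.natAbs = 1 := by
    rw [hy, ← Complex.exp_nat_mul, Complex.exp_eq_one_iff]
    obtain h | h := Int.natAbs_eq m
    · refine ⟨-x, ?_⟩
      have h' : (m : ℂ) = (m.natAbs : ℂ) := by
        rw [← Int.cast_natCast, ← h]
      rw [← h']
      push_cast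
      field_simp
    · refine ⟨x, ?_⟩
      have h' : (m.natAbs : ℂ) = -(m : ℂ) := by
        have : (m.natAbs : ℤ) = -m := by omega
        rw [← Int.cast_natCast, this, Int.cast_neg]
      rw [h']
      field_simp
  rw [hsum]
  split_ifs with h
  · rw [hone.2 h]
    rw [habs]
    simp only [one_pow, Finset.sum_const, Finset.card_range, nsmul_eq_mul, mul_one,
      Int.cast_natCast]
  · have h0 := mul_geom_sum y m.natAbs
    rw [hroot, sub_self] at h0
    exact (mul_eq_zero.1 h0).resolve_left (sub_ne_zero.2 fun h' => h (hone.1 h'))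

/-- Orthogonality of the characters of `(ℤ/mℤ)^s`. -/
lemma sum_zpowV_epsPt_eq_ite {s : ℕ} {m : ℤ} (hm : m ≠ 0) (x : ZS s) :
    ∑ e ∈ Fintype.piFinset (fun _ : Fin s => Finset.Ico 0 |m|), zpowV (epsPt m e) x =
      if ∀ i, m ∣ x i then ((|m| : ℤ) : ℂ) ^ s else 0 := by
  unfold zpowV epsPt
  rw [← Finset.prod_univ_sum (fun _ : Fin s => Finset.Ico 0 |m|)
    (fun i e => Complex.exp (-(2 * Real.pi * Complex.I * (e : ℤ)) / m) ^ x i)]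
  simp_rw [sum_exp_zpow_eq_ite hm]
  split_ifs with h
  · simp [h]
  · push Not at h
    obtain ⟨i, hi⟩ := h
    exact Finset.prod_eq_zero (Finset.mem_univ i) (if_neg hi)

lemma epsPt_ne_zero {s : ℕ} (m : ℤ) (e : ZS s) (i : Fin s) : epsPt m e i ≠ 0 :=
  Complex.exp_ne_zero _

lemma zpowV_sub {s : ℕ} {z : Fin s → ℂ} (hz : ∀ i, z i ≠ 0) (x y : ZS s) :
    zpowV z (fun i => x i - y i) = zpowV z x * (zpowV z y)⁻¹ := by
  simp only [zpowV, zpow_sub₀ (hz _), div_eq_mul_inv,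
    Finset.prod_mul_distrib, Finset.prod_inv_distrib]

lemma zpowV_ne_zero {s : ℕ} {z : Fin s → ℂ} (hz : ∀ i, z i ≠ 0) (x : ZS s) : zpowV z x ≠ 0 :=
  Finset.prod_ne_zero_iff.2 fun i _ => zpow_ne_zero _ (hz i)

/-- If the nontrivial discrete Fourier coefficients of `f` vanish, then all sums of `f` over
residue classes modulo `m` agree. -/
lemma sum_residue_class_eq {s : ℕ} {m : ℤ} (hm : m ≠ 0) (T : Finset (ZS s)) (f : ZS s → ℂ)
    (hf : ∀ e : ZS s, inE m e → e ≠ 0 → ∑ α ∈ T, f α * zpowV (epsPt m e) α = 0) (γ : ZS s) :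
    (∑ α ∈ T, if ∀ i, m ∣ α i - γ i then f α else 0) =
      ∑ α ∈ T, if ∀ i, m ∣ α i then f α else 0 := by
  have hms : ((|m| : ℤ) : ℂ) ^ s ≠ 0 := pow_ne_zero _ (by exact_mod_cast abs_ne_zero.2 hm)
  have key : ∀ δ : ZS s, ((|m| : ℤ) : ℂ) ^ s *
      (∑ α ∈ T, if ∀ i, m ∣ α i - δ i then f α else 0) = ∑ α ∈ T, f α := by
    intro δ
    calc ((|m| : ℤ) : ℂ) ^ s * (∑ α ∈ T, if ∀ i, m ∣ α i - δ i then f α else 0)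
        = ∑ α ∈ T, ∑ e ∈ Fintype.piFinset (fun _ : Fin s => Finset.Ico 0 |m|),
            f α * zpowV (epsPt m e) (fun i => α i - δ i) := by
          rw [Finset.mul_sum]
          refine Finset.sum_congr rfl fun α _ => ?_
          rw [← Finset.mul_sum, sum_zpowV_epsPt_eq_ite hm]
          split_ifs <;> ring
      _ = ∑ e ∈ Fintype.piFinset (fun _ : Fin s => Finset.Ico 0 |m|),
            (∑ α ∈ T, f α * zpowV (epsPt m e) α) * (zpowV (epsPt m e) δ)⁻¹ := by
          rw [Finset.sum_comm]
          refine Finset.sum_congr rfl fun e _ => ?_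
          rw [Finset.sum_mul]
          refine Finset.sum_congr rfl fun α _ => ?_
          rw [zpowV_sub (epsPt_ne_zero m e), mul_assoc]
      _ = ∑ α ∈ T, f α := by
          rw [Finset.sum_eq_single_of_mem (0 : ZS s)]
          · simp [zpowV, epsPt]
          · simp [Fintype.mem_piFinset, hm]
          · intro e he h0
            rw [hf e (by simpa [inE, Fintype.mem_piFinset] using he) h0, zero_mul]
  have h0 := key 0
  simp only [Pi.zero_apply, sub_zero] at h0
  exact mul_left_cancel₀ hms ((key γ).trans h0.symm)

lemma symbolD_eq_sum {s : ℕ} {a : ZS s → ℝ} (ha : (Function.support a).Finite) (j : Fin s → ℕ)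
    {z : Fin s → ℂ} (hz : ∀ i, z i ≠ 0) :
    symbolD a j z = (∑ α ∈ ha.toFinset, (a α : ℂ) * qpolyC j (fun i => (α i : ℂ)) * zpowV z α) *
      (zpowV z (fun i => (j i : ℤ)))⁻¹ := by
  rw [symbolD, finsum_eq_sum_of_support_subset (s := ha.toFinset), Finset.sum_mul]
  · refine Finset.sum_congr rfl fun α _ => ?_
    rw [zpowV_sub hz]
    ring
  · intro α hα
    simp only [Function.mem_support, Set.Finite.coe_toFinset] at hα ⊢
    intro h
    simp [h] at hα

/-- Vanishing derivatives of the symbol up to order `k` annihilate all products of powers of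
affine functions of total degree at most `k`. -/
lemma sum_mask_affine_eq_zero {s : ℕ} {a : ZS s → ℝ} (ha : (Function.support a).Finite) {k : ℕ}
    {z : Fin s → ℂ} (hz : ∀ i, z i ≠ 0)
    (hD : ∀ j : Fin s → ℕ, (∑ i, j i) ≤ k → symbolD a j z = 0)
    (u v : Fin s → ℂ) (j : Fin s → ℕ) (hj : (∑ i, j i) ≤ k) :
    ∑ α ∈ ha.toFinset, (a α : ℂ) * (∏ i, (u i + v i * α i) ^ j i) * zpowV z α = 0 := by
  choose c hc using fun i => affine_pow_eq_sum_falling (u i) (v i) (j i)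
  have hexp : ∀ α : ZS s, ∏ i, (u i + v i * (α i : ℂ)) ^ j i =
      ∑ l ∈ Fintype.piFinset (fun i => Finset.range (j i + 1)),
        (∏ i, c i (l i)) * qpolyC l (fun i => (α i : ℂ)) := by
    intro α
    simp_rw [hc, Finset.prod_univ_sum, Finset.prod_mul_distrib, qpolyC]
  simp_rw [hexp, Finset.mul_sum, Finset.sum_mul]
  rw [Finset.sum_comm]
  refine Finset.sum_eq_zero fun l hl => ?_
  have hle : ∑ i, l i ≤ k := by
    refine (Finset.sum_le_sum fun i _ => ?_).trans hj
    have := Fintype.mem_piFinset.1 hl i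
    simp only [Finset.mem_range] at this
    omega
  have h0 := hD l hle
  rw [symbolD_eq_sum ha l hz] at h0
  have h1 := (mul_eq_zero.1 h0).resolve_right (inv_ne_zero (zpowV_ne_zero hz _))
  calc _ = (∏ i, c i (l i)) *
      ∑ α ∈ ha.toFinset, (a α : ℂ) * qpolyC l (fun i => (α i : ℂ)) * zpowV z α := by
        rw [Finset.mul_sum]
        exact Finset.sum_congr rfl fun α _ => by ring
    _ = 0 := by rw [h1, mul_zero]

lemma finite_support_subdOp {s : ℕ} {m : ℤ} (hm : m ≠ 0) {a : ZS s → ℝ}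
    (ha : (Function.support a).Finite) (d : ZS s → ℝ) (γ : ZS s) :
    (Function.support fun β : ZS s => a (γ - m • β) * d β).Finite := by
  refine (ha.preimage (f := fun β : ZS s => γ - m • β) ?_).subset ?_
  · intro β _ β' _ h
    exact smul_right_injective _ hm (sub_right_injective h)
  · intro β hβ
    exact left_ne_zero_of_mul hβ

/-- Summation over the coset `γ - mℤ^s` as a sum over the residue class of `γ`. -/
lemma finsum_coset_eq_sum {s : ℕ} {m : ℤ} (hm : m ≠ 0) (T : Finset (ZS s)) (f : ZS s → ℂ)
    (hf : ∀ α ∉ T, f α = 0) (γ : ZS s) :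
    ∑ᶠ β : ZS s, f (γ - m • β) = ∑ α ∈ T, if ∀ i, m ∣ α i - γ i then f α else 0 := by
  have hinj : Function.Injective fun β : ZS s => γ - m • β := fun β β' h =>
    smul_right_injective _ hm (sub_right_injective h)
  have hmem : ∀ α : ZS s, α ∈ Set.range (fun β : ZS s => γ - m • β) ↔ ∀ i, m ∣ α i - γ i := by
    intro α
    constructor
    · rintro ⟨β, rfl⟩ i
      exact ⟨-β i, by simp⟩
    · intro h
      choose β hβ using h
      refine ⟨fun i => -β i, funext fun i => ?_⟩
      simp only [Pi.sub_apply, Pi.smul_apply, smul_eq_mul]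
      linear_combination -hβ i
  rw [← finsum_mem_range (f := f) hinj, finsum_mem_def,
    finsum_eq_sum_of_support_subset (s := T)]
  · refine Finset.sum_congr rfl fun α _ => ?_
    by_cases h : ∀ i, m ∣ α i - γ i
    · rw [Set.indicator_of_mem ((hmem α).2 h), if_pos h]
    · rw [Set.indicator_of_notMem (mt (hmem α).1 h), if_neg h]
  · intro α hα
    by_contra h
    exact hα (by simp [hf α h])

/-- An interpolatory scheme generating polynomials up to degree `k` maps the samples of a monomial
of degree at most `k` to its samples on the refined grid. -/
lemma subdOp_monomial {s : ℕ} {m : ℤ} (hm : m ≠ 0) {a : ZS s → ℝ}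
    (ha : (Function.support a).Finite) (hint0 : a 0 = 1)
    (hint : ∀ α : ZS s, α ≠ 0 → a (m • α) = 0) {k : ℕ}
    (hz : ∀ j : Fin s → ℕ, (∑ i, j i) ≤ k →
      ∀ e : ZS s, inE m e → e ≠ 0 → symbolD a j (epsPt m e) = 0)
    (c : ℝ) (j : Fin s → ℕ) (hj : (∑ i, j i) ≤ k) (γ : ZS s) :
    subdOp m a (fun β => ∏ i, ((β i : ℝ) * c) ^ j i) γ = ∏ i, ((γ i : ℝ) * c / m) ^ j i := by
  have hmC : (m : ℂ) ≠ 0 := by exact_mod_cast hm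
  set f : ZS s → ℂ := fun α =>
    (a α : ℂ) * ∏ i, ((γ i : ℂ) * c / m + -(c / m : ℂ) * α i) ^ j i with hf
  have hfT : ∀ α ∉ ha.toFinset, f α = 0 := by
    intro α hα
    have h0 : a α = 0 := by simpa using hα
    simp [hf, h0]
  have hclass := sum_residue_class_eq hm ha.toFinset f (fun e he he0 =>
    sum_mask_affine_eq_zero ha (epsPt_ne_zero m e) (fun l hl => hz l hl e he he0) _ _ j hj) γ
  have hzero := finsum_coset_eq_sum hm ha.toFinset f hfT 0
  simp only [Pi.zero_apply, sub_zero] at hzero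
  rw [← finsum_coset_eq_sum hm ha.toFinset f hfT γ, ← hzero,
    finsum_eq_single (fun β : ZS s => f (0 - m • β)) 0] at hclass
  · apply Complex.ofReal_injective
    have hleft : ((subdOp m a (fun β => ∏ i, ((β i : ℝ) * c) ^ j i) γ : ℝ) : ℂ) =
        ∑ᶠ β : ZS s, f (γ - m • β) := by
      rw [subdOp]
      refine ((Complex.ofRealHom.toAddMonoidHom.map_finsum_of_injective
        Complex.ofReal_injective _)).trans (finsum_congr fun β => ?_)
      simp only [hf, RingHom.toAddMonoidHom_eq_coe, AddMonoidHom.coe_coe, Complex.ofRealHom_eq_coe,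
        Pi.sub_apply, Pi.smul_apply, smul_eq_mul]
      push_cast
      congr 1
      refine Finset.prod_congr rfl fun i _ => ?_
      congr 1
      field_simp
      ring
    rw [hleft, hclass]
    simp [hf, hint0]
  · intro β hβ
    have h0 := hint (-β) (neg_ne_zero.2 hβ)
    rw [smul_neg] at h0
    simp only [hf, zero_sub, h0, Complex.ofReal_zero, zero_mul]

/-- An interpolatory scheme generating polynomials up to degree `k` reproduces them in each
refinement step. -/
lemma stepwiseReproduces_of_interpolatory {s : ℕ} {m : ℤ} (hm : m ≠ 0) {a : ZS s → ℝ}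
    (ha : (Function.support a).Finite) (hint0 : a 0 = 1)
    (hint : ∀ α : ZS s, α ≠ 0 → a (m • α) = 0) {k : ℕ}
    (hz : ∀ j : Fin s → ℕ, (∑ i, j i) ≤ k →
      ∀ e : ZS s, inE m e → e ≠ 0 → symbolD a j (epsPt m e) = 0) :
    StepwiseReproduces m a 0 k := by
  intro π hπ r γ
  simp only [subdOp, MvPolynomial.eval_eq', Finset.mul_sum]
  rw [finsum_sum_comm]
  · refine Finset.sum_congr rfl fun d hd => ?_
    have hdeg : ∑ i, d i ≤ k := by
      refine le_trans ?_ hπ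
      have h := MvPolynomial.le_totalDegree hd
      rwa [Finsupp.sum_fintype _ _ fun _ => rfl] at h
    have hmono := subdOp_monomial hm ha hint0 hint hz ((m : ℝ) ^ r)⁻¹ d hdeg γ
    simp only [subdOp] at hmono
    simp only [mul_left_comm (a _) (MvPolynomial.coeff d π)]
    rw [← mul_finsum]
    congr 1
    simp only [param, Pi.zero_apply, zero_mul, sub_zero, div_eq_mul_inv, pow_succ, mul_inv,
      mul_assoc] at hmono ⊢
    exact hmono
  · intro d _
    exact finite_support_subdOp hm ha _ γ

/-- Step-wise reproduction implies reproduction. -/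
lemma StepwiseReproduces.reproduces {s : ℕ} {m : ℤ} {a : ZS s → ℝ} {k : ℕ}
    (h : StepwiseReproduces m a 0 k) : Reproduces m a 0 k := by
  intro π hπ
  refine ⟨fun _ x => MvPolynomial.eval x π, fun _ => MvPolynomial.continuous_eval π, ?_, ?_⟩
  · intro r
    induction r with
    | zero => intro α; simp [funext (fun i => (by simp [param] : param m 0 0 α i = (α i : ℝ)))]
    | succ r ih =>
      intro α
      rw [Function.iterate_succ_apply']
      refine (h π hπ r α).symm.trans ?_
      exact congrArg (fun d => subdOp m a d α) (funext ih)
  · exact fun u hu => Eventually.of_forall fun _ _ => refl_mem_uniformity hu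

/-- A convergent interpolatory subdivision scheme which generates polynomials
up to degree `k` (i.e. `a(1,…,1) = |m|^s` and `(D^j a)(ε) = 0` for all `ε ∈ Ξ'`, `|j| ≤ k`)
reproduces polynomials up to degree `k` with the standard parametrization (`τ = 0`). -/
theorem stmt16 {s : ℕ} (hs : 1 ≤ s) (m : ℤ) (hm : 2 ≤ |m|)
    (a : ZS s → ℝ) (ha : (Function.support a).Finite)
    (hint0 : a 0 = 1) (hint : ∀ α : ZS s, α ≠ 0 → a (m • α) = 0) (k : ℕ)
    (hconv : Convergent m a 0)
    (h1 : symbolD a 0 onesC = ((|m| : ℤ) : ℂ) ^ s)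
    (hz : ∀ j : Fin s → ℕ, (∑ i, j i) ≤ k →
      ∀ e : ZS s, inE m e → e ≠ 0 → symbolD a j (epsPt m e) = 0) :
    Reproduces m a 0 k := by
  have hm0 : m ≠ 0 := by
    rintro rfl
    norm_num at hm
  exact (stepwiseReproduces_of_interpolatory hm0 ha hint0 hint hz).reproduces

end
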